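/- Let a = (a_{ij}) be a positive definite symmetric n×n real matrix with λ|ξ|² ≤ a_{ij}ξ_iξ_j ≤ Λ|ξ|². Then there exists a weight w : S^{n-1} → ℝ, given by w(θ) = 1/(det(a) · (a^{-1}θ)·θ) up to a dimensional normalization, which is bounded below and above by positive constants depending only on n, λ, Λ, such that for every C² function u and every x, a_{ij} ∂_{ij} u(x) = ∫_{S^{n-1}} ∂_{θθ} u(x) w(θ) dθ, where ∂_{θθ}u denotes the second derivative of u in the direction θ. -/

import Mathlib

open MeasureTheory Metric
open scoped RealInnerProductSpace

section Polar

variable {E F : Type*} [NormedAddCommGroup E] [NormedSpace ℝ E] [FiniteDimensional ℝ E]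
  [Nontrivial E] [MeasurableSpace E] [BorelSpace E] (μ : Measure E) [μ.IsAddHaarMeasure]
  [NormedAddCommGroup F] [NormedSpace ℝ F]

/-- Integration in polar coordinates. -/
theorem integral_eq_integral_toSphere_integral_Ioi {f : E → F} (hf : Integrable f μ) :
    ∫ x, f x ∂μ = ∫ θ : sphere (0 : E) 1, (∫ r in Set.Ioi (0 : ℝ),
      r ^ (Module.finrank ℝ E - 1) • f (r • (θ : E))) ∂μ.toSphere := by
  have hmp := μ.measurePreserving_homeomorphUnitSphereProd
  have hme := (homeomorphUnitSphereProd E).measurableEmbedding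
  have hcomp (x : ({0}ᶜ : Set E)) :
      f ((homeomorphUnitSphereProd E x).2.1 • ((homeomorphUnitSphereProd E x).1 : E)) = f x := by
    congr 1
    simp [norm_ne_zero_iff.2 x.2]
  have hfi : Integrable (fun p : sphere (0 : E) 1 × Set.Ioi (0 : ℝ) ↦ f (p.2.1 • (p.1 : E)))
      (μ.toSphere.prod (.volumeIoiPow (Module.finrank ℝ E - 1))) := by
    rw [← hmp.integrable_comp_emb hme]
    simp only [Function.comp_def, hcomp]
    have := (integrableOn_iff_comap_subtypeVal (μ := μ) (f := f)
      (measurableSet_singleton (0 : E)).compl).1 hf.integrableOn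
    exact this
  calc
    ∫ x, f x ∂μ = ∫ x : ({0}ᶜ : Set E), f x ∂(μ.comap (↑)) := by
      rw [integral_subtype_comap (measurableSet_singleton _).compl f, restrict_compl_singleton]
    _ = ∫ p, f (p.2.1 • (p.1 : E))
        ∂μ.toSphere.prod (.volumeIoiPow (Module.finrank ℝ E - 1)) := by
      rw [← hmp.integral_comp hme]
      simp only [hcomp]
    _ = _ := by
      rw [integral_prod _ hfi]
      refine integral_congr_ae (.of_forall fun θ ↦ ?_)
      simp only [Measure.volumeIoiPow, ENNReal.ofReal]
      rw [integral_withDensity_eq_integral_smul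
          (measurable_subtype_coe.pow_const _).real_toNNReal,
        integral_subtype_comap measurableSet_Ioi
          fun a ↦ Real.toNNReal (a ^ (Module.finrank ℝ E - 1)) • f (a • (θ : E)),
        setIntegral_congr_fun measurableSet_Ioi fun x hx ↦ ?_]
      rw [NNReal.smul_def, Real.coe_toNNReal _ (pow_nonneg hx.out.le _)]

/-- The integral of a `k`-homogeneous function over the star-shaped set `p < 1`, where `p` is positive
and positively homogeneous, as an integral over the unit sphere. -/
theorem setIntegral_lt_one_eq_integral_toSphere {p h : E → ℝ} (hpm : Measurable p)
    (hp : ∀ r > 0, ∀ x, p (r • x) = r * p x) (hp0 : ∀ x ≠ 0, 0 < p x)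
    (k : ℕ) (hh : ∀ r > 0, ∀ x, h (r • x) = r ^ k * h x)
    (hfi : IntegrableOn h {x | p x < 1} μ) :
    ∫ x in {x | p x < 1}, h x ∂μ =
      ∫ θ : sphere (0 : E) 1, h θ * ((Module.finrank ℝ E + k) * p θ ^ (Module.finrank ℝ E + k))⁻¹
        ∂μ.toSphere := by
  have hs : MeasurableSet {x | p x < 1} := hpm measurableSet_Iio
  rw [← integral_indicator hs,
    integral_eq_integral_toSphere_integral_Ioi μ ((integrable_indicator_iff hs).2 hfi)]
  refine integral_congr_ae (.of_forall fun θ ↦ ?_)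
  have hd : 0 < Module.finrank ℝ E := Module.finrank_pos
  set d := Module.finrank ℝ E
  have hθ : 0 < p θ := hp0 θ (ne_zero_of_mem_unit_sphere θ)
  have hR : 0 < (p θ)⁻¹ := inv_pos.2 hθ
  calc
    _ = ∫ r in Set.Ioi (0 : ℝ), (Set.Iio (p θ)⁻¹).indicator (fun r ↦ r ^ (d - 1 + k) * h θ) r := by
      refine setIntegral_congr_fun measurableSet_Ioi fun r (hr : 0 < r) ↦ ?_
      have : r • (θ : E) ∈ {x | p x < 1} ↔ r ∈ Set.Iio (p θ)⁻¹ := by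
        simp [hp r hr, lt_inv_comm₀ hr hθ, ← lt_div_iff₀ hθ]
      by_cases hrp : r ∈ Set.Iio (p θ)⁻¹
      · simp only [Set.indicator_of_mem hrp, Set.indicator_of_mem (this.2 hrp), hh r hr,
          smul_eq_mul, pow_add]
        ring
      · simp only [Set.indicator_of_notMem hrp, Set.indicator_of_notMem (mt this.1 hrp), smul_zero]
    _ = ∫ r in (0 : ℝ)..(p θ)⁻¹, r ^ (d - 1 + k) * h θ := by
      rw [setIntegral_indicator measurableSet_Iio, Set.Ioi_inter_Iio,
        intervalIntegral.integral_of_le hR.le, integral_Ioc_eq_integral_Ioo]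
    _ = _ := by
      rw [intervalIntegral.integral_mul_const, integral_pow]
      have e : d - 1 + k + 1 = d + k := by lia
      have e' : ((d - 1 + k : ℕ) : ℝ) + 1 = d + k := by exact_mod_cast e
      rw [e, e', zero_pow (by lia), inv_pow]
      field_simp
      simp

end Polar

theorem OrthonormalBasis.bilin_apply_self_eq_sum {E ι : Type*} [NormedAddCommGroup E]
    [InnerProductSpace ℝ E] [Fintype ι] (b : OrthonormalBasis ι ℝ E) (T : E →L[ℝ] E →L[ℝ] ℝ)
    (x : E) :
    T x x = ∑ i, ∑ j, ⟪b i, x⟫ * ⟪b j, x⟫ * T (b i) (b j) := by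
  conv_lhs => rw [← b.sum_repr' x]
  simp only [map_sum, map_smul, sum_apply, smul_apply, smul_eq_mul, Finset.mul_sum, mul_assoc]
  rw [Finset.sum_comm]
  simp only [mul_left_comm]

section Moments

variable {E : Type*} [NormedAddCommGroup E] [InnerProductSpace ℝ E] [FiniteDimensional ℝ E]
  [MeasurableSpace E] [BorelSpace E]

theorem Continuous.integrableOn_unitBall {f : E → ℝ} (hf : Continuous f) :
    IntegrableOn f (ball 0 1) :=
  (hf.continuousOn.integrableOn_compact (isCompact_closedBall 0 1)).mono_set ball_subset_closedBall

theorem setIntegral_unitBall_inner_sq_eq_of_norm_eq {v w : E} (h : ‖v‖ = ‖w‖) :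
    ∫ y in ball (0 : E) 1, ⟪v, y⟫ ^ 2 = ∫ y in ball (0 : E) 1, ⟪w, y⟫ ^ 2 := by
  set R : E ≃ₗᵢ[ℝ] E := (ℝ ∙ (v - w))ᗮ.reflection
  have hR : R v = w := Submodule.reflection_sub h
  rw [← R.measurePreserving.setIntegral_preimage_emb R.toHomeomorph.measurableEmbedding
    (fun y ↦ ⟪w, y⟫ ^ 2)]
  simp [← hR]

/-- The second moments of the unit ball are a multiple of the inner product. -/
theorem exists_setIntegral_unitBall_inner_mul_inner [Nontrivial E] :
    ∃ c > 0, ∀ v w : E, ∫ y in ball (0 : E) 1, ⟪v, y⟫ * ⟪w, y⟫ = c * ⟪v, w⟫ := by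
  obtain ⟨e, he⟩ := exists_norm_eq E zero_le_one
  set c := ∫ y in ball (0 : E) 1, ⟪e, y⟫ ^ 2
  have hsq (v : E) : ∫ y in ball (0 : E) 1, ⟪v, y⟫ ^ 2 = c * ‖v‖ ^ 2 := by
    rw [setIntegral_unitBall_inner_sq_eq_of_norm_eq (w := ‖v‖ • e) (by simp [norm_smul, he])]
    simp_rw [real_inner_smul_left, mul_pow]
    rw [integral_const_mul, mul_comm]
  refine ⟨c, ?_, fun v w ↦ ?_⟩
  · have hc : Continuous fun y : E ↦ ⟪e, y⟫ ^ 2 := by fun_prop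
    refine (setIntegral_pos_iff_support_of_nonneg_ae (.of_forall fun y ↦ sq_nonneg _)
      hc.integrableOn_unitBall).2 ?_
    refine (hc.isOpen_support.inter isOpen_ball).measure_pos _ ⟨(2⁻¹ : ℝ) • e, ?_, ?_⟩
    · simp [real_inner_smul_right, he]
    · simp [norm_smul, he]
      norm_num
  · have h (y : E) : ⟪v, y⟫ * ⟪w, y⟫ = 4⁻¹ * (⟪v + w, y⟫ ^ 2 - ⟪v - w, y⟫ ^ 2) := by
      rw [inner_add_left, inner_sub_left]
      ring
    simp_rw [h]
    rw [integral_const_mul, integral_sub, hsq, hsq, norm_add_sq_real, norm_sub_sq_real]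
    · ring
    all_goals exact Continuous.integrableOn_unitBall (by fun_prop)

theorem setIntegral_norm_symm_lt_one (L : E ≃L[ℝ] E) (h : E → ℝ) :
    ∫ x in {x | ‖L.symm x‖ < 1}, h x =
      |(L : E →L[ℝ] E).det| * ∫ y in ball (0 : E) 1, h (L y) := by
  have hs : {x | ‖L.symm x‖ < 1} = L '' ball (0 : E) 1 := by
    rw [L.image_eq_preimage_symm]
    ext
    simp
  rw [hs, integral_image_eq_integral_abs_det_fderiv_smul (f := L) volume measurableSet_ball
    (fun y _ ↦ (L : E →L[ℝ] E).hasFDerivAt.hasFDerivWithinAt) L.injective.injOn]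
  simp [integral_const_mul]

theorem ContinuousLinearMap.abs_det_le_pow {L : E →L[ℝ] E} {K : ℝ} (hK : 0 ≤ K)
    (hL : ∀ x, ‖L x‖ ≤ K * ‖x‖) : |L.det| ≤ K ^ Module.finrank ℝ E := by
  have h := measure_mono (μ := (volume : Measure E))
    (show L '' closedBall 0 1 ⊆ closedBall 0 K by
      rintro _ ⟨x, hx, rfl⟩
      simp only [mem_closedBall, dist_zero_right] at hx ⊢
      exact (hL x).trans (mul_le_of_le_one_right hK hx))
  rw [Measure.addHaar_image_continuousLinearMap, Measure.addHaar_closedBall' _ _ hK] at h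
  rw [ENNReal.mul_le_mul_iff_left (measure_closedBall_pos _ _ one_pos).ne'
    measure_closedBall_lt_top.ne, ENNReal.ofReal_le_ofReal_iff (by positivity)] at h
  exact h

/-- If `m‖x‖ ≤ ‖L x‖ ≤ K‖x‖`, then `|det L| ‖L⁻¹θ‖ ^ k` is bounded on the unit sphere. -/
theorem ContinuousLinearEquiv.abs_det_mul_norm_symm_pow_mem_Icc (L : E ≃L[ℝ] E) {m K : ℝ}
    (hm : 0 < m) (hK : 0 < K) (hle : ∀ x, m * ‖x‖ ≤ ‖L x‖) (hge : ∀ x, ‖L x‖ ≤ K * ‖x‖) (k : ℕ)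
    {θ : E} (hθ : ‖θ‖ = 1) :
    |(L : E →L[ℝ] E).det| * ‖L.symm θ‖ ^ k ∈
      Set.Icc (m ^ Module.finrank ℝ E * K⁻¹ ^ k) (K ^ Module.finrank ℝ E * m⁻¹ ^ k) := by
  have hdet_le : |(L : E →L[ℝ] E).det| ≤ K ^ Module.finrank ℝ E :=
    ContinuousLinearMap.abs_det_le_pow hK.le hge
  have hle_det : m ^ Module.finrank ℝ E ≤ |(L : E →L[ℝ] E).det| := by
    have h := ContinuousLinearMap.abs_det_le_pow (L := (L.symm : E →L[ℝ] E))
      (inv_nonneg.2 hm.le) fun x ↦ by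
        rw [← div_eq_inv_mul, le_div_iff₀' hm]
        simpa using hle (L.symm x)
    have hmul : (L : E →L[ℝ] E).det * (L.symm : E →L[ℝ] E).det = 1 :=
      L.toLinearEquiv.det_mul_det_symm
    have hdet : 0 < |(L : E →L[ℝ] E).det| := abs_pos.2 (left_ne_zero_of_mul_eq_one hmul)
    rw [eq_inv_of_mul_eq_one_right hmul, abs_inv, inv_pow] at h
    exact (inv_le_inv₀ hdet (by positivity)).1 h
  have hlo : K⁻¹ ≤ ‖L.symm θ‖ := by
    rw [inv_le_iff_one_le_mul₀' hK]
    simpa [hθ] using hge (L.symm θ)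
  have hhi : ‖L.symm θ‖ ≤ m⁻¹ := by
    rw [← one_div, le_div_iff₀' hm]
    simpa [hθ] using hle (L.symm θ)
  constructor <;> gcongr

/-- The trace of a bilinear form `T` against `L * Lᵀ` is a weighted average of `T θ θ` over the unit
sphere. -/
theorem integral_toSphere_bilin [Nontrivial E] :
    ∃ c > 0, ∀ (L : E ≃L[ℝ] E) {ι : Type} [Fintype ι] (b : OrthonormalBasis ι ℝ E)
      (T : E →L[ℝ] E →L[ℝ] ℝ),
      ∑ i, T (L (b i)) (L (b i)) =
        ∫ θ : sphere (0 : E) 1, T θ θ * (c * (|(L : E →L[ℝ] E).det| *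
          ‖L.symm θ‖ ^ (Module.finrank ℝ E + 2)))⁻¹ ∂(volume : Measure E).toSphere := by
  obtain ⟨c, hc, hcE⟩ := exists_setIntegral_unitBall_inner_mul_inner (E := E)
  refine ⟨c * (Module.finrank ℝ E + 2), by positivity, fun L ι _ b T ↦ ?_⟩
  have hdet : 0 < |(L : E →L[ℝ] E).det| :=
    abs_pos.2 (LinearEquiv.isUnit_det' L.toLinearEquiv).ne_zero
  have hfi : IntegrableOn (fun x ↦ T x x) {x | ‖L.symm x‖ < 1} := by
    have hK : IsCompact (L '' closedBall (0 : E) 1) := (isCompact_closedBall 0 1).image L.continuous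
    have hT : Continuous fun x ↦ T x x := by fun_prop
    refine (hT.continuousOn.integrableOn_compact hK).mono_set fun x hx ↦
      ⟨L.symm x, by simpa using (show ‖L.symm x‖ < 1 from hx).le, by simp⟩
  have hpolar := setIntegral_lt_one_eq_integral_toSphere (volume : Measure E)
    (p := fun x ↦ ‖L.symm x‖) (h := fun x ↦ T x x) (by fun_prop)
    (fun r hr x ↦ by simp [norm_smul, abs_of_pos hr]) (fun x hx ↦ by simpa using hx) 2
    (fun r hr x ↦ by simp; ring) hfi
  have hball : ∫ y in ball (0 : E) 1, T (L y) (L y) = c * ∑ i, T (L (b i)) (L (b i)) := by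
    have h (y : E) : T (L y) (L y) =
        ∑ i, ∑ j, ⟪b i, y⟫ * ⟪b j, y⟫ * T (L (b i)) (L (b j)) :=
      b.bilin_apply_self_eq_sum (T.bilinearComp (L : E →L[ℝ] E) (L : E →L[ℝ] E)) y
    simp_rw [h]
    rw [integral_finsetSum _ fun i _ ↦ Continuous.integrableOn_unitBall (by fun_prop),
      Finset.mul_sum]
    refine Finset.sum_congr rfl fun i _ ↦ ?_
    rw [integral_finsetSum _ fun j _ ↦ Continuous.integrableOn_unitBall (by fun_prop)]
    classical
    simp [integral_mul_const, hcE, b.inner_eq_ite]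
  rw [setIntegral_norm_symm_lt_one, hball] at hpolar
  rw [← mul_right_inj' (mul_pos hdet hc).ne', mul_assoc, hpolar, ← integral_const_mul]
  refine integral_congr_ae (.of_forall fun θ ↦ ?_)
  have := hc.ne'
  have := hdet.ne'
  push_cast
  field_simp

end Moments

section Matrix

variable {ι : Type*} [Fintype ι] [DecidableEq ι]

theorem inner_toEuclideanCLM_self (a : Matrix ι ι ℝ) (ξ : EuclideanSpace ℝ ι) :
    ⟪ξ, Matrix.toEuclideanCLM (𝕜 := ℝ) a ξ⟫ = ∑ i, ∑ j, a i j * ξ i * ξ j := by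
  rw [Matrix.inner_toEuclideanCLM]
  simp only [dotProduct, Matrix.mulVec, Finset.mul_sum]
  exact Finset.sum_congr rfl fun i _ ↦ Finset.sum_congr rfl fun j _ ↦ by ring

open scoped MatrixOrder in
/-- The symmetric square root of a positive definite matrix, as an invertible operator. -/
theorem exists_continuousLinearEquiv_sqrt {a : Matrix ι ι ℝ} (ha : a.IsSymm) {lam : ℝ}
    (hlam : 0 < lam)
    (h : ∀ ξ : EuclideanSpace ℝ ι, lam * ‖ξ‖ ^ 2 ≤ ∑ i, ∑ j, a i j * ξ i * ξ j) :
    ∃ L : EuclideanSpace ℝ ι ≃L[ℝ] EuclideanSpace ℝ ι,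
      (∀ ξ, ‖L ξ‖ ^ 2 = ∑ i, ∑ j, a i j * ξ i * ξ j) ∧
      ∀ i j, ∑ k, L (EuclideanSpace.single k 1) i * L (EuclideanSpace.single k 1) j = a i j := by
  have hpos : a.PosSemidef := by
    refine Matrix.PosSemidef.of_dotProduct_mulVec_nonneg ?_ fun x ↦ ?_
    · rw [Matrix.IsHermitian, Matrix.conjTranspose_eq_transpose_of_trivial, ha.eq]
    · have := h (WithLp.toLp 2 x)
      rw [← inner_toEuclideanCLM_self, Matrix.inner_toEuclideanCLM] at this
      exact (by positivity : 0 ≤ lam * ‖WithLp.toLp 2 x‖ ^ 2).trans this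
  set B := CFC.sqrt a
  have hB : B * B = a := CFC.sqrt_mul_sqrt_self a hpos.nonneg
  have hBsa : IsSelfAdjoint B := (CFC.sqrt_nonneg a).isSelfAdjoint
  have hBsymm : B.IsSymm := by
    rw [Matrix.IsSymm, ← Matrix.conjTranspose_eq_transpose_of_trivial]
    exact hBsa
  set M := Matrix.toEuclideanCLM (𝕜 := ℝ) B
  have hM (ξ : EuclideanSpace ℝ ι) : ‖M ξ‖ ^ 2 = ∑ i, ∑ j, a i j * ξ i * ξ j := by
    have hMsa : IsSelfAdjoint M := hBsa.map _
    rw [← inner_toEuclideanCLM_self, ← hB, map_mul, mul_apply_eq_comp,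
      ← real_inner_self_eq_norm_sq, ← ContinuousLinearMap.adjoint_inner_left, hMsa.adjoint_eq,
      real_inner_comm]
  have hinj : Function.Injective M := by
    refine (injective_iff_map_eq_zero M).2 fun ξ hξ ↦ ?_
    have := h ξ
    rw [← hM, hξ, norm_zero, zero_pow two_ne_zero] at this
    exact norm_eq_zero.1 (pow_eq_zero_iff two_ne_zero |>.1
      (le_antisymm (nonpos_of_mul_nonpos_right this hlam) (sq_nonneg _)))
  obtain ⟨L, hLM⟩ : ∃ L : EuclideanSpace ℝ ι ≃L[ℝ] EuclideanSpace ℝ ι, ∀ ξ, L ξ = M ξ :=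
    ⟨(LinearEquiv.ofInjectiveEndo (M : _ →ₗ[ℝ] _) hinj).toContinuousLinearEquiv, fun _ ↦ rfl⟩
  refine ⟨L, fun ξ ↦ by rw [hLM, hM], fun i j ↦ ?_⟩
  have hcol (k i : ι) : M (EuclideanSpace.single k 1) i = B i k := by
    simp [M, Matrix.ofLp_toEuclideanCLM]
  calc
    _ = ∑ k, B i k * B j k := Finset.sum_congr rfl fun k _ ↦ by
      rw [hLM, hcol, hcol]
    _ = a i j := by
      rw [← hB, Matrix.mul_apply]
      refine Finset.sum_congr rfl fun k _ ↦ ?_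
      rw [hBsymm.apply j k]

end Matrix



/-- every uniformly elliptic constant-coefficient operator
`a_{ij} ∂_{ij}` is an average of pure second directional derivatives over the unit
sphere against a weight `w` bounded between positive constants `c₁, c₂` depending
only on `n, λ, Λ`:  `a_{ij} ∂_{ij} u(x) = ∫_{S^{n-1}} ∂_{θθ} u(x) w(θ) dθ`. -/
theorem elliptic_operator_as_sphere_average (n : ℕ) (hn : 0 < n)
    (lam Lam : ℝ) (hlam : 0 < lam) (hLam : lam ≤ Lam) :
    ∃ c₁ c₂ : ℝ, 0 < c₁ ∧ c₁ ≤ c₂ ∧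
      ∀ a : Matrix (Fin n) (Fin n) ℝ, a.IsSymm →
      (∀ ξ : EuclideanSpace ℝ (Fin n),
        lam * ‖ξ‖ ^ 2 ≤ ∑ i, ∑ j, a i j * ξ i * ξ j ∧
        ∑ i, ∑ j, a i j * ξ i * ξ j ≤ Lam * ‖ξ‖ ^ 2) →
      ∃ w : EuclideanSpace ℝ (Fin n) → ℝ,
        (∀ θ : EuclideanSpace ℝ (Fin n), θ ∈ sphere (0 : EuclideanSpace ℝ (Fin n)) 1 →
          c₁ ≤ w θ ∧ w θ ≤ c₂) ∧
        ∀ u : EuclideanSpace ℝ (Fin n) → ℝ, ContDiff ℝ 2 u →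
        ∀ x : EuclideanSpace ℝ (Fin n),
          ∑ i, ∑ j, a i j *
            iteratedFDeriv ℝ 2 u x ![EuclideanSpace.single i 1, EuclideanSpace.single j 1] =
          ∫ θ : sphere (0 : EuclideanSpace ℝ (Fin n)) 1,
            iteratedFDeriv ℝ 2 u x ![(θ : EuclideanSpace ℝ (Fin n)), (θ : EuclideanSpace ℝ (Fin n))] * w θ
            ∂((volume : Measure (EuclideanSpace ℝ (Fin n))).toSphere) := by
  have hdim : Module.finrank ℝ (EuclideanSpace ℝ (Fin n)) = n := finrank_euclideanSpace_fin
  have : Nontrivial (EuclideanSpace ℝ (Fin n)) := Module.nontrivial_of_finrank_pos (hdim ▸ hn)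
  obtain ⟨c, hc, hcE⟩ := integral_toSphere_bilin (E := EuclideanSpace ℝ (Fin n))
  rw [hdim] at hcE
  have hLam0 : 0 < Lam := hlam.trans_le hLam
  have hsl : 0 < √lam := Real.sqrt_pos.2 hlam
  have hsL : 0 < √Lam := Real.sqrt_pos.2 hLam0
  have hsle : √lam ≤ √Lam := Real.sqrt_le_sqrt hLam
  refine ⟨(c * (√Lam ^ n * (√lam)⁻¹ ^ (n + 2)))⁻¹, (c * (√lam ^ n * (√Lam)⁻¹ ^ (n + 2)))⁻¹,
    by positivity, by gcongr, fun a ha hell ↦ ?_⟩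
  obtain ⟨L, hL, hLa⟩ := exists_continuousLinearEquiv_sqrt ha hlam fun ξ ↦ (hell ξ).1
  have hle (ξ : EuclideanSpace ℝ (Fin n)) : √lam * ‖ξ‖ ≤ ‖L ξ‖ := by
    rw [← pow_le_pow_iff_left₀ (by positivity) (by positivity) two_ne_zero, mul_pow,
      Real.sq_sqrt hlam.le, hL]
    exact (hell ξ).1
  have hge (ξ : EuclideanSpace ℝ (Fin n)) : ‖L ξ‖ ≤ √Lam * ‖ξ‖ := by
    rw [← pow_le_pow_iff_left₀ (by positivity) (by positivity) two_ne_zero, mul_pow,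
      Real.sq_sqrt hLam0.le, hL]
    exact (hell ξ).2
  refine ⟨fun θ ↦ (c * (|(L : EuclideanSpace ℝ (Fin n) →L[ℝ] EuclideanSpace ℝ (Fin n)).det| *
    ‖L.symm θ‖ ^ (n + 2)))⁻¹, fun θ hθ ↦ ?_, fun u _ x ↦ ?_⟩
  · obtain ⟨hlo, hhi⟩ := hdim ▸ L.abs_det_mul_norm_symm_pow_mem_Icc hsl hsL hle hge (n + 2)
      (mem_sphere_zero_iff_norm.1 hθ)
    have := (by positivity : 0 < √lam ^ n * (√Lam)⁻¹ ^ (n + 2)).trans_le hlo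
    exact ⟨inv_anti₀ (by positivity) (by gcongr), inv_anti₀ (by positivity) (by gcongr)⟩
  · simp only [iteratedFDeriv_two_apply, Matrix.cons_val_zero, Matrix.cons_val_one]
    rw [← hcE L (EuclideanSpace.basisFun (Fin n) ℝ)]
    simp only [(EuclideanSpace.basisFun (Fin n) ℝ).bilin_apply_self_eq_sum _ (L _),
      EuclideanSpace.basisFun_apply, EuclideanSpace.inner_single_left, map_one, one_mul, ← hLa,
      Finset.sum_mul]
    rw [Finset.sum_comm_cycle]
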